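/- Let K be a number field of degree n over ℚ and let s > 1 be a real number. Then ζ_K(s) ≤ ζ(s)^n, where ζ_K(s) = ∑_I N(I)^(−s) (the sum over all nonzero ideals I of O_K) and ζ(s) = ∑_{m≥1} m^(−s) is the Riemann zeta function. -/

import Mathlib

open NumberField

open Ideal UniqueFactorizationMonoid

lemma Ideal.card_primesOver_le_finrank {R S : Type*} [CommRing R] [CommRing S] [Algebra R S]
    [IsDomain R] [Module.Finite R S] [Module.Flat R S]
    (p : Ideal R) [p.IsPrime] :
    Nat.card (p.primesOver S) ≤ Module.finrank R S := by
  have : Fintype (p.primesOver S) := (Algebra.QuasiFinite.finite_primesOver p).fintype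
  rw [← Ideal.sum_ramification_inertia_eq_finrank p S, Nat.card_eq_fintype_card,
    Fintype.card_eq_sum_ones]
  refine Finset.sum_le_sum fun q _ ↦ ?_
  have : q.1.IsPrime := q.2.1
  have : q.1.LiesOver p := q.2.2
  exact Nat.one_le_iff_ne_zero.mpr <| mul_ne_zero (Ideal.ramificationIdx_pos q.1 R).ne'
    (Ideal.inertiaDeg_pos q.1 R).ne'

/-- The prime ideals of a finite flat extension can be coloured by `finrank R S` colours so that
distinct primes over the same prime of `R` get distinct colours. -/
lemma Ideal.exists_coloring_injOn_primesOver (R S : Type*) [CommRing R] [CommRing S] [Algebra R S]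
    [IsDomain R] [Module.Finite R S] [Module.Flat R S] (h : 0 < Module.finrank R S) :
    ∃ c : Ideal S → Fin (Module.finrank R S), ∀ P Q : Ideal S, P.IsPrime → Q.IsPrime →
      P.under R = Q.under R → c P = c Q → P = Q := by
  have key (p : Ideal R) : ∃ c : Ideal S → Fin (Module.finrank R S),
      p.IsPrime → Set.InjOn c (p.primesOver S) := by
    by_cases hp : p.IsPrime
    · have : Fintype (p.primesOver S) := (Algebra.QuasiFinite.finite_primesOver p).fintype
      obtain ⟨e⟩ : Nonempty (p.primesOver S ↪ Fin (Module.finrank R S)) :=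
        Function.Embedding.nonempty_of_card_le (by
          rw [Fintype.card_fin, ← Nat.card_eq_fintype_card]
          exact p.card_primesOver_le_finrank)
      classical
      refine ⟨fun P ↦ if hP : P ∈ p.primesOver S then e ⟨P, hP⟩ else ⟨0, h⟩,
        fun _ P hP Q hQ hPQ ↦ ?_⟩
      simpa [hP, hQ] using hPQ
    · exact ⟨fun _ ↦ ⟨0, h⟩, fun h' ↦ absurd h' hp⟩
  choose c hc using key
  refine ⟨fun P ↦ c (P.under R) P, fun P Q hP hQ hPQ hcol ↦
    hc (P.under R) inferInstance ⟨hP, ⟨rfl⟩⟩ ⟨hQ, ⟨hPQ⟩⟩ ?_⟩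
  simpa only [hPQ] using hcol

lemma Ideal.under_eq_span_of_dvd_absNorm {S : Type*} [CommRing S] [IsDedekindDomain S]
    [Module.Free ℤ S] [Module.Finite ℤ S] {P : Ideal S} [P.IsPrime] (hP : P ≠ ⊥) {p : ℕ}
    (hp : p.Prime) (h : p ∣ absNorm P) : P.under ℤ = span {(p : ℤ)} := by
  have : NeZero P := ⟨hP⟩
  rw [← Ideal.pow_inertiaDeg (absNorm (P.under ℤ)) P] at h
  rw [(Nat.prime_dvd_prime_iff_eq hp (Nat.absNorm_under_prime P)).mp (hp.dvd_of_dvd_pow h),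
    Int.ideal_span_absNorm_eq_self]

lemma Multiset.factorization_prod_map_filter {α ι : Type*} [DecidableEq α] [DecidableEq ι]
    (f : α → ℕ) (c : α → ι) (p : ℕ) (a : α) (s : Multiset α) (h0 : ∀ b ∈ s, f b ≠ 0)
    (h : ∀ b ∈ s, c b = c a → p ∣ f b → b = a) :
    ((s.filter (c · = c a)).map f).prod.factorization p = s.count a * (f a).factorization p := by
  induction s using Multiset.induction_on with
  | empty => simp
  | cons b s ih =>
    have ih := ih (fun x hx ↦ h0 x (Multiset.mem_cons_of_mem hx))
      (fun x hx ↦ h x (Multiset.mem_cons_of_mem hx))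
    have hb := h0 b (Multiset.mem_cons_self b s)
    by_cases hc : c b = c a
    · have hprod : ((s.filter (c · = c a)).map f).prod ≠ 0 := by
        rw [Ne, Multiset.prod_eq_zero_iff]
        simp only [Multiset.mem_map, Multiset.mem_filter, not_exists, not_and]
        exact fun x hx ↦ h0 x (Multiset.mem_cons_of_mem hx.1)
      rw [Multiset.filter_cons_of_pos (p := (c · = c a)) _ hc, Multiset.map_cons, Multiset.prod_cons,
        Nat.factorization_mul hb hprod, Finsupp.add_apply, ih]
      by_cases hba : b = a
      · subst hba
        rw [Multiset.count_cons_self]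
        ring
      · rw [Multiset.count_cons_of_ne (Ne.symm hba), Nat.factorization_eq_zero_of_not_dvd
          (fun hd ↦ hba (h b (Multiset.mem_cons_self b s) hc hd)), zero_add]
    · rw [Multiset.filter_cons_of_neg (p := (c · = c a)) _ hc, ih, Multiset.count_cons_of_ne]
      rintro rfl
      exact hc rfl

lemma Multiset.prod_prod_map_filter {α ι M : Type*} [Fintype ι] [DecidableEq ι] [CommMonoid M]
    (f : α → M) (c : α → ι) (s : Multiset α) :
    ∏ i, ((s.filter (c · = i)).map f).prod = (s.map f).prod := by
  induction s using Multiset.induction_on with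
  | empty => simp
  | cons b s ih =>
    simp_rw [Multiset.filter_cons, Multiset.map_add, Multiset.prod_add, Finset.prod_mul_distrib, ih,
      Multiset.map_cons, Multiset.prod_cons]
    congr 1
    rw [Finset.prod_eq_single (c b)] <;> simp +contextual [eq_comm]

/-- Nonzero ideals of `𝓞 K` embed in `[K : ℚ]`-tuples of positive integers, in such a way that the
norm of an ideal is the product of the entries of the tuple. -/
lemma NumberField.exists_injective_prod_eq_absNorm (K : Type*) [Field K] [NumberField K] :
    ∃ φ : {I : Ideal (𝓞 K) // I ≠ 0} → Fin (Module.finrank ℚ K) → ℕ,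
      Function.Injective φ ∧ ∀ I, ∏ i, φ I i = absNorm I.1 := by
  classical
  rw [← RingOfIntegers.rank]
  obtain ⟨c, hc⟩ := Ideal.exists_coloring_injOn_primesOver ℤ (𝓞 K) Module.finrank_pos
  have hprime {I P : Ideal (𝓞 K)} (hP : P ∈ normalizedFactors I) : P.IsPrime :=
    isPrime_of_prime (prime_of_normalized_factor P hP)
  have hne {I P : Ideal (𝓞 K)} (hP : P ∈ normalizedFactors I) : P ≠ ⊥ :=
    (prime_of_normalized_factor P hP).ne_zero
  refine ⟨fun I i ↦ (((normalizedFactors I.1).filter (c · = i)).map absNorm).prod, ?_, ?_⟩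
  · intro I J hIJ
    have count_eq {P : Ideal (𝓞 K)} (hP : P.IsPrime) (hP0 : P ≠ ⊥) :
        (normalizedFactors I.1).count P = (normalizedFactors J.1).count P := by
      have h1 : absNorm P ≠ 1 := by rw [Ne, absNorm_eq_one_iff]; exact hP.ne_top
      obtain ⟨p, hp, hpP⟩ := Nat.exists_prime_and_dvd h1
      have hN : absNorm P ≠ 0 := by rwa [Ne, absNorm_eq_zero_iff]
      have key (L : Ideal (𝓞 K)) := Multiset.factorization_prod_map_filter absNorm c p P
        (normalizedFactors L) (fun Q hQ ↦ by rw [Ne, absNorm_eq_zero_iff]; exact hne hQ)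
        (fun Q hQ hcol hd ↦ by
          have := hprime hQ
          refine hc Q P this hP ?_ hcol
          rw [under_eq_span_of_dvd_absNorm (hne hQ) hp hd, under_eq_span_of_dvd_absNorm hP0 hp hpP])
      have h := congrArg (fun m : ℕ ↦ m.factorization p) (congrFun hIJ (c P))
      dsimp only at h
      rw [key, key] at h
      exact Nat.eq_of_mul_eq_mul_right (hp.factorization_pos_of_dvd hN hpP) h
    have hfac : normalizedFactors I.1 = normalizedFactors J.1 := by
      ext P
      by_cases hP : P ∈ normalizedFactors I.1 ∨ P ∈ normalizedFactors J.1
      · exact hP.elim (fun h ↦ count_eq (hprime h) (hne h)) fun h ↦ count_eq (hprime h) (hne h)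
      · rw [not_or] at hP
        rw [Multiset.count_eq_zero_of_notMem hP.1, Multiset.count_eq_zero_of_notMem hP.2]
    ext1
    rw [← Ideal.prod_normalizedFactors_eq_self I.2, hfac, Ideal.prod_normalizedFactors_eq_self J.2]
  · intro I
    dsimp only
    rw [Multiset.prod_prod_map_filter, ← map_multiset_prod, Ideal.prod_normalizedFactors_eq_self I.2]

/-- If `α` embeds in the `n`-tuples of positive integers, then the Dirichlet series of the products
of the entries is at most `ζ(s) ^ n`. -/
lemma tsum_inv_prod_rpow_le_pow {α : Type*} {n : ℕ} {φ : α → Fin n → ℕ}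
    (hinj : Function.Injective φ) (hpos : ∀ a, ∏ i, φ a i ≠ 0) {s : ℝ} (hs : 1 < s) :
    ∑' a, (((∏ i, φ a i : ℕ) : ℝ) ^ s)⁻¹ ≤ (∑' m : ℕ, (((m : ℝ) + 1) ^ s)⁻¹) ^ n := by
  classical
  have hsum : Summable fun m : ℕ ↦ (((m : ℝ) + 1) ^ s)⁻¹ := by
    simpa using (summable_nat_add_iff 1).mpr (Real.summable_nat_rpow_inv.mpr hs)
  obtain ⟨ψ, hψφ⟩ : ∃ ψ : α → Fin n → ℕ, ∀ a i, φ a i = ψ a i + 1 :=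
    ⟨fun a i ↦ φ a i - 1, fun a i ↦ (Nat.succ_pred_eq_of_ne_zero
      (Finset.prod_ne_zero_iff.mp (hpos a) i (Finset.mem_univ i))).symm⟩
  have hψinj : Function.Injective ψ := fun a b h ↦ hinj <| funext fun i ↦ by
    rw [hψφ, hψφ, h]
  have hterm (a : α) : (((∏ i, φ a i : ℕ) : ℝ) ^ s)⁻¹ = ∏ i, (((ψ a i : ℝ) + 1) ^ s)⁻¹ := by
    rw [Finset.prod_inv_distrib, Real.finsetProd_rpow _ _ (fun i _ ↦ by positivity)]
    simp only [hψφ, Nat.cast_prod, Nat.cast_add, Nat.cast_one]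
  refine Real.tsum_le_of_sum_le (fun a ↦ by positivity) fun u ↦ ?_
  set t : Finset ℕ := u.biUnion fun a ↦ Finset.univ.image (ψ a)
  calc ∑ a ∈ u, (((∏ i, φ a i : ℕ) : ℝ) ^ s)⁻¹
      = ∑ x ∈ u.image ψ, ∏ i, (((x i : ℝ) + 1) ^ s)⁻¹ := by
        rw [Finset.sum_image hψinj.injOn]
        exact Finset.sum_congr rfl fun a _ ↦ hterm a
    _ ≤ ∑ x ∈ Fintype.piFinset fun _ : Fin n ↦ t, ∏ i, (((x i : ℝ) + 1) ^ s)⁻¹ := by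
        refine Finset.sum_le_sum_of_subset_of_nonneg (fun x hx ↦ ?_) fun _ _ _ ↦ by positivity
        obtain ⟨a, ha, rfl⟩ := Finset.mem_image.mp hx
        exact Fintype.mem_piFinset.mpr fun i ↦ Finset.mem_biUnion.mpr
          ⟨a, ha, Finset.mem_image_of_mem _ (Finset.mem_univ i)⟩
    _ = (∑ m ∈ t, (((m : ℝ) + 1) ^ s)⁻¹) ^ n :=
        (Finset.sum_pow' t (fun m : ℕ ↦ (((m : ℝ) + 1) ^ s)⁻¹) n).symm
    _ ≤ _ := by
        gcongr
        exact hsum.sum_le_tsum t fun _ _ ↦ by positivity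

/-- For a number field K of degree n over ℚ and a real number s > 1, the
Dedekind zeta value ζ_K(s) = ∑_{I ≠ 0} N(I)^(−s) is at most ζ(s)^n, where
ζ(s) = ∑_{m ≥ 1} m^(−s) is the Riemann zeta function. -/
theorem dedekindZeta_le_riemannZeta_pow (K : Type*) [Field K] [NumberField K]
    (s : ℝ) (hs : 1 < s) :
    (∑' I : {I : Ideal (𝓞 K) // I ≠ 0}, ((Ideal.absNorm I.1 : ℝ) ^ s)⁻¹)
      ≤ (∑' m : ℕ, (((m : ℝ) + 1) ^ s)⁻¹) ^ Module.finrank ℚ K := by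
  obtain ⟨φ, hinj, hprod⟩ := NumberField.exists_injective_prod_eq_absNorm K
  have hpos (I : {I : Ideal (𝓞 K) // I ≠ 0}) : ∏ i, φ I i ≠ 0 := by
    rw [hprod, Ne, absNorm_eq_zero_iff]
    exact I.2
  simpa only [hprod] using tsum_inv_prod_rpow_le_pow hinj hpos hs
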